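/- Let g : ℝ → ℝ be a smooth odd function. Then there exists a smooth function h : ℝ → ℝ such that g(t) = t·h(t²) for all t. -/

import Mathlib

open Filter Topology Asymptotics
open scoped ContDiff

/-- The derivative of `t ↦ ∫₀¹ sᵏ f(st) ds` is `t ↦ ∫₀¹ sᵏ⁺¹ (deriv f)(st) ds`. -/
theorem hasDerivAt_integral_pow_mul_comp_mul {f : ℝ → ℝ} (hf : ContDiff ℝ 1 f) (k : ℕ) (t : ℝ) :
    HasDerivAt (fun t => ∫ s in (0 : ℝ)..1, s ^ k * f (s * t))
      (∫ s in (0 : ℝ)..1, s ^ (k + 1) * deriv f (s * t)) t := by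
  have hc : Continuous f := hf.continuous
  have hd : Continuous (deriv f) := hf.continuous_deriv le_rfl
  obtain ⟨C, hC⟩ := (isCompact_Icc (a := -(|t| + 1)) (b := |t| + 1)).exists_bound_of_continuousOn
    hd.continuousOn
  refine (intervalIntegral.hasDerivAt_integral_of_dominated_loc_of_deriv_le
    (F := fun t s => s ^ k * f (s * t)) (F' := fun t s => s ^ (k + 1) * deriv f (s * t))
    (s := Metric.ball t 1) (bound := fun _ => C) (Metric.ball_mem_nhds t one_pos)
    (.of_forall fun x => (by fun_prop : Continuous _).aestronglyMeasurable)
    ((by fun_prop : Continuous _).intervalIntegrable _ _)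
    (by fun_prop : Continuous _).aestronglyMeasurable ?_ (by simp) ?_).2
  · refine .of_forall fun s hs x hx => ?_
    rw [Set.uIoc_of_le zero_le_one] at hs
    have hx' : |x| ≤ |t| + 1 := by
      have h₁ : |x - t| < 1 := hx
      have h₂ := abs_add_le (x - t) t
      rw [sub_add_cancel] at h₂
      linarith
    have hsx : s * x ∈ Set.Icc (-(|t| + 1)) (|t| + 1) := by
      rw [Set.mem_Icc, ← abs_le, abs_mul, abs_of_pos hs.1]
      nlinarith [abs_nonneg x, hs.1, hs.2]
    have hb := hC _ hsx
    have hp : |s ^ (k + 1)| ≤ 1 := by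
      rw [abs_of_nonneg (pow_nonneg hs.1.le _)]
      exact pow_le_one₀ hs.1.le hs.2
    rw [norm_mul, Real.norm_eq_abs]
    exact (mul_le_of_le_one_left (norm_nonneg _) hp).trans hb
  · refine .of_forall fun s _ x _ => ?_
    have h₁ : HasDerivAt (fun x => s * x) s x := by simpa using (hasDerivAt_id x).const_mul s
    have h₂ := ((hf.differentiable one_ne_zero (s * x)).hasDerivAt.comp x h₁).const_mul (s ^ k)
    exact h₂.congr_deriv (by ring)

theorem contDiff_integral_pow_mul_comp_mul {f : ℝ → ℝ} (hf : ContDiff ℝ ∞ f) (k : ℕ) :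
    ContDiff ℝ ∞ (fun t => ∫ s in (0 : ℝ)..1, s ^ k * f (s * t)) := by
  refine contDiff_infty.2 fun n => ?_
  induction n generalizing f k with
  | zero =>
    have hc := hf.continuous
    refine contDiff_zero.2 ?_
    exact intervalIntegral.continuous_parametric_intervalIntegral_of_continuous' (by fun_prop) _ _
  | succ n ih =>
    have hd := hasDerivAt_integral_pow_mul_comp_mul (hf.of_le (by simp)) k
    rw [Nat.cast_add, Nat.cast_one, contDiff_succ_iff_deriv]
    refine ⟨fun t => (hd t).differentiableAt, by simp, ?_⟩
    rw [show deriv _ = _ from funext fun t => (hd t).deriv]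
    exact ih (contDiff_infty_iff_deriv.1 hf).2 (k + 1)

/-- **Hadamard's lemma** on the line. -/
theorem ContDiff.exists_eq_mul_of_zero {f : ℝ → ℝ} (hf : ContDiff ℝ ∞ f) (h0 : f 0 = 0) :
    ∃ q : ℝ → ℝ, ContDiff ℝ ∞ q ∧ ∀ t, f t = t * q t := by
  refine ⟨_, contDiff_integral_pow_mul_comp_mul (contDiff_infty_iff_deriv.1 hf).2 0, fun t => ?_⟩
  have hd : Continuous (deriv f) := hf.continuous_deriv (by simp)
  have := intervalIntegral.integral_eq_sub_of_hasDerivAt (a := 0) (b := 1)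
    (f := fun s => f (s * t)) (f' := fun s => t * deriv f (s * t)) (fun s _ => ?_)
    ((by fun_prop : Continuous _).intervalIntegrable _ _)
  · simpa [h0] using this.symm
  · have h₁ : HasDerivAt (fun s => s * t) t s := by simpa using (hasDerivAt_id s).mul_const t
    have h₂ := (hf.differentiable (by simp) (s * t)).hasDerivAt.comp s h₁
    exact h₂.congr_deriv (by ring)

theorem eq_of_forall_ne_zero {f g : ℝ → ℝ} (hf : Continuous f) (hg : Continuous g)
    (h : ∀ t ≠ 0, f t = g t) : f = g :=
  hf.ext_on (dense_compl_singleton 0) hg h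

theorem isBigO_pow_of_eq_pow_mul {f q : ℝ → ℝ} {N : ℕ} (hq : Continuous q)
    (h : ∀ t, f t = t ^ N * q t) : f =O[𝓝 0] fun t => t ^ N := by
  have := (isBigO_refl (fun t : ℝ => t ^ N) (𝓝 0)).mul ((hq.tendsto 0).isBigO_one ℝ)
  simpa [← h] using this

theorem ContDiff.exists_eq_pow_mul_of_isBigO {f : ℝ → ℝ} (hf : ContDiff ℝ ∞ f) {N : ℕ}
    (hO : f =O[𝓝 0] fun t => t ^ N) :
    ∃ q : ℝ → ℝ, ContDiff ℝ ∞ q ∧ ∀ t, f t = t ^ N * q t := by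
  induction N with
  | zero => exact ⟨f, hf, by simp⟩
  | succ N ih =>
    have hO' : (fun t : ℝ => t ^ (N + 1)) =o[𝓝 0] fun t => t ^ N :=
      isLittleO_pow_pow N.lt_succ_self
    obtain ⟨q, hq, hfq⟩ := ih (hO.trans hO'.isBigO)
    have hq0 : q 0 = 0 := by
      have hlim : Tendsto (fun t => f t / t ^ N) (𝓝[≠] 0) (𝓝 0) :=
        ((hO.trans_isLittleO hO').mono nhdsWithin_le_nhds).tendsto_div_nhds_zero
      refine tendsto_nhds_unique ((hq.continuous.tendsto 0).mono_left nhdsWithin_le_nhds)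
        (hlim.congr' ?_)
      filter_upwards [self_mem_nhdsWithin] with t ht
      rw [hfq, mul_div_cancel_left₀ _ (pow_ne_zero _ ht)]
    obtain ⟨r, hr, hqr⟩ := hq.exists_eq_mul_of_zero hq0
    exact ⟨r, hr, fun t => by rw [hfq, hqr, pow_succ, mul_assoc]⟩

/-- A smooth function on the line vanishing to infinite order at the origin. -/
structure IsFlatAtZero (f : ℝ → ℝ) : Prop where
  contDiff : ContDiff ℝ ∞ f
  isBigO : ∀ N : ℕ, f =O[𝓝 0] fun t => t ^ N

namespace IsFlatAtZero

variable {f : ℝ → ℝ}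

theorem exists_eq_pow_mul (hf : IsFlatAtZero f) (N : ℕ) :
    ∃ q : ℝ → ℝ, ContDiff ℝ ∞ q ∧ ∀ t, f t = t ^ N * q t :=
  hf.contDiff.exists_eq_pow_mul_of_isBigO (hf.isBigO N)

theorem apply_zero (hf : IsFlatAtZero f) : f 0 = 0 := by
  obtain ⟨q, -, h⟩ := hf.exists_eq_pow_mul 1
  simp [h]

theorem deriv (hf : IsFlatAtZero f) : IsFlatAtZero (deriv f) := by
  refine ⟨(contDiff_infty_iff_deriv.1 hf.contDiff).2, fun N => ?_⟩
  obtain ⟨q, hq, h⟩ := hf.exists_eq_pow_mul (N + 1)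
  have hq' : Continuous (_root_.deriv q) := hq.continuous_deriv (by simp)
  have hc := hq.continuous
  refine isBigO_pow_of_eq_pow_mul (q := fun t => (N + 1) * q t + t * _root_.deriv q t)
    (by fun_prop) fun t => ?_
  rw [funext h]
  have := ((hasDerivAt_pow (N + 1) t).mul (hq.differentiable (by simp) t).hasDerivAt).deriv
  refine Eq.trans this ?_
  rw [Nat.add_sub_cancel]
  push_cast
  ring

theorem exists_eq_mul (hf : IsFlatAtZero f) :
    ∃ q : ℝ → ℝ, IsFlatAtZero q ∧ ∀ t, f t = t * q t := by
  obtain ⟨q, hq, h⟩ := hf.contDiff.exists_eq_mul_of_zero hf.apply_zero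
  refine ⟨q, ⟨hq, fun N => ?_⟩, h⟩
  obtain ⟨r, hr, h'⟩ := hf.exists_eq_pow_mul (N + 1)
  have hc := hr.continuous
  refine isBigO_pow_of_eq_pow_mul hc (congrFun (eq_of_forall_ne_zero hq.continuous
    (by fun_prop) fun t ht => mul_left_cancel₀ ht ?_))
  rw [← h, h']
  ring

theorem const_mul (hf : IsFlatAtZero f) (c : ℝ) : IsFlatAtZero fun t => c * f t :=
  ⟨contDiff_const.mul hf.contDiff, fun N => (hf.isBigO N).const_mul_left c⟩

theorem exists_hasDerivAt_comp_sqrt (hf : IsFlatAtZero f) :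
    ∃ q : ℝ → ℝ, IsFlatAtZero q ∧ ∀ x, HasDerivAt (fun x => f (√x)) (q (√x)) x := by
  obtain ⟨q, hq, h⟩ := hf.deriv.exists_eq_mul
  refine ⟨fun t => 2⁻¹ * q t, hq.const_mul _, fun x => ?_⟩
  rcases lt_trichotomy x 0 with hx | rfl | hx
  · have : (fun x => f (√x)) =ᶠ[𝓝 x] fun _ => 0 := by
      filter_upwards [gt_mem_nhds hx] with y hy
      rw [Real.sqrt_eq_zero_of_nonpos hy.le, hf.apply_zero]
    refine ((hasDerivAt_const x 0).congr_of_eventuallyEq this).congr_deriv ?_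
    simp [Real.sqrt_eq_zero_of_nonpos hx.le, hq.apply_zero]
  · rw [hasDerivAt_iff_isLittleO_nhds_zero]
    simp only [Real.sqrt_zero, hq.apply_zero, hf.apply_zero, zero_add, mul_zero, sub_zero,
      smul_zero]
    have hs : Tendsto Real.sqrt (𝓝 0) (𝓝 0) := by
      simpa using Real.continuous_sqrt.tendsto 0
    have h₁ : (fun x => f (√x)) =O[𝓝 0] fun x => √x ^ 4 := (hf.isBigO 4).comp_tendsto hs
    have h₂ : (fun x : ℝ => √x ^ 4) =O[𝓝 0] fun x => x ^ 2 := by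
      refine .of_bound 1 (.of_forall fun x => ?_)
      rcases le_total 0 x with hx | hx
      · rw [show √x ^ 4 = (√x ^ 2) ^ 2 by ring, Real.sq_sqrt hx, one_mul]
      · simp [Real.sqrt_eq_zero_of_nonpos hx, sq_nonneg]
    exact (h₁.trans h₂).trans_isLittleO (isLittleO_pow_id one_lt_two)
  · have hd := (hf.contDiff.differentiable (by simp) (√x)).hasDerivAt.comp x
      (Real.hasDerivAt_sqrt hx.ne')
    have := (Real.sqrt_pos.2 hx).ne'
    refine hd.congr_deriv ?_
    rw [h]
    field_simp

theorem contDiff_comp_sqrt (hf : IsFlatAtZero f) : ContDiff ℝ ∞ fun x => f (√x) := by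
  refine contDiff_infty.2 fun n => ?_
  induction n generalizing f with
  | zero =>
    have := hf.contDiff.continuous
    exact contDiff_zero.2 (by fun_prop)
  | succ n ih =>
    obtain ⟨q, hq, hd⟩ := hf.exists_hasDerivAt_comp_sqrt
    rw [Nat.cast_add, Nat.cast_one, contDiff_succ_iff_deriv]
    refine ⟨fun t => (hd t).differentiableAt, by simp, ?_⟩
    rw [show _root_.deriv _ = _ from funext fun t => (hd t).deriv]
    exact ih hq

end IsFlatAtZero

theorem exists_bound_iteratedDeriv_of_hasCompactSupport {f : ℝ → ℝ} (hf : ContDiff ℝ ∞ f)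
    (hs : HasCompactSupport f) (n : ℕ) :
    ∃ M : ℝ, 1 ≤ M ∧ ∀ k ≤ n, ∀ x, ‖iteratedDeriv k f x‖ ≤ M := by
  have hb (k : ℕ) : ∃ C, ∀ x, ‖iteratedDeriv k f x‖ ≤ C := by
    simp_rw [← norm_iteratedFDeriv_eq_norm_iteratedDeriv]
    exact (hs.iteratedFDeriv k).exists_bound_of_continuous
      (hf.continuous_iteratedFDeriv (by exact_mod_cast le_top))
  choose C hC using hb
  refine ⟨1 + ∑ k ∈ Finset.range (n + 1), |C k|,
    le_add_of_nonneg_right (Finset.sum_nonneg fun _ _ => abs_nonneg _), fun k hk x => ?_⟩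
  have h₁ := Finset.single_le_sum (f := fun k => |C k|) (fun _ _ => abs_nonneg _)
    (Finset.mem_range.2 (Nat.lt_succ_of_le hk))
  linarith [hC k x, le_abs_self (C k)]

/-- **Borel's lemma**: every real sequence is the sequence of Taylor coefficients at `0` of a smooth
function. -/
theorem exists_contDiff_sub_sum_isBigO (c : ℕ → ℝ) :
    ∃ b : ℝ → ℝ, ContDiff ℝ ∞ b ∧
      ∀ N : ℕ, (fun x => b x - ∑ n ∈ Finset.range N, c n * x ^ n) =O[𝓝 0] fun x => x ^ N := by
  let χ : ContDiffBump (0 : ℝ) := ⟨1 / 2, 1, by norm_num, by norm_num⟩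
  have hχ : ContDiff ℝ ∞ χ := χ.contDiff
  have hΘ (n : ℕ) : ContDiff ℝ ∞ fun y => y ^ n * χ y := (contDiff_id.pow n).mul hχ
  choose M hM1 hM using fun n => exists_bound_iteratedDeriv_of_hasCompactSupport (hΘ n)
    (χ.hasCompactSupport.mul_left) n
  let L : ℕ → ℝ := fun n => 1 + |c n| * M n * 2 ^ n
  have hL1 (n : ℕ) : 1 ≤ L n := by
    have := hM1 n
    exact le_add_of_nonneg_right (by positivity)
  have hL0 (n : ℕ) : 0 < L n := one_pos.trans_le (hL1 n)
  have hLc (n : ℕ) : |c n| * M n / L n ≤ (1 / 2) ^ n := by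
    rw [div_le_iff₀ (hL0 n), one_div, inv_pow, ← div_eq_inv_mul, le_div_iff₀ (by positivity)]
    simp [L]
  have hLp {n k : ℕ} (hk : k < n) : (L n)⁻¹ ^ (n - k) ≤ (L n)⁻¹ := by
    refine pow_le_of_le_one (inv_nonneg.2 (hL0 n).le) (inv_le_one_of_one_le₀ (hL1 n)) (by omega)
  let u : ℕ → ℝ → ℝ := fun n x => c n * x ^ n * χ (L n * x)
  have hu (n : ℕ) : ContDiff ℝ ∞ (u n) :=
    (contDiff_const.mul (contDiff_id.pow n)).mul (hχ.comp (contDiff_const.mul contDiff_id))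
  have hu' (n : ℕ) : u n = fun x => (c n * (L n)⁻¹ ^ n) * ((L n * x) ^ n * χ (L n * x)) := by
    funext x
    have := (hL0 n).ne'
    simp only [u, mul_pow, inv_pow]
    field_simp
  have hsum : Summable fun n : ℕ => ((1 : ℝ) / 2) ^ n := summable_geometric_two
  have hder {n k : ℕ} (hk : k < n) (x : ℝ) : ‖iteratedDeriv k (u n) x‖ ≤ (1 / 2) ^ n := by
    have hΘk : ContDiff ℝ k fun y => y ^ n * χ y := (hΘ n).of_le (by exact_mod_cast le_top)
    rw [hu', iteratedDeriv_const_mul_field, iteratedDeriv_comp_const_mul hΘk]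
    have hpow : (L n)⁻¹ ^ n * L n ^ k = (L n)⁻¹ ^ (n - k) := by
      have := (hL0 n).ne'
      rw [← pow_sub_mul_pow _ hk.le, mul_assoc, ← mul_pow, inv_mul_cancel₀ this, one_pow, mul_one]
    calc _ = |c n| * (L n)⁻¹ ^ (n - k) * ‖iteratedDeriv k (fun y => y ^ n * χ y) (L n * x)‖ := by
          rw [← hpow]
          simp only [norm_mul, norm_pow, norm_inv, Real.norm_eq_abs, abs_of_pos (hL0 n)]
          ring
      _ ≤ |c n| * (L n)⁻¹ * M n := by
          have := hM n k hk.le (L n * x)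
          have := hLp hk
          have := inv_nonneg.2 (hL0 n).le
          gcongr
      _ = |c n| * M n / L n := by ring
      _ ≤ _ := hLc n
  refine ⟨fun x => ∑' n, u n x, ?_, fun N => ?_⟩
  · refine contDiff_tsum_of_eventually (v := fun _ n => (1 / 2) ^ n) hu (fun _ _ => hsum)
      fun k _ => ?_
    rw [Nat.cofinite_eq_atTop]
    filter_upwards [eventually_gt_atTop k] with n hn x
    rw [norm_iteratedFDeriv_eq_norm_iteratedDeriv]
    exact hder hn x
  · have hsummable (x : ℝ) : Summable fun n => u n x := by
      refine .of_norm_bounded_eventually_nat hsum ?_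
      filter_upwards [eventually_gt_atTop 0] with n hn
      simpa using hder hn x
    have hhead : ∀ᶠ x in 𝓝 (0 : ℝ), ∀ n ∈ Finset.range (N + 1), u n x = c n * x ^ n := by
      refine (eventually_all_finset _).2 fun n _ => ?_
      have hlim : Tendsto (fun x => L n * x) (𝓝 0) (𝓝 0) := by
        simpa using (continuous_const_mul (L n)).tendsto 0
      filter_upwards [hlim.eventually χ.eventuallyEq_one] with x hx
      simp only [u, hx, Pi.one_apply, mul_one]
    have htail (x : ℝ) (i : ℕ) :
        ‖u (i + (N + 1)) x‖ ≤ (1 / 2) ^ (i + (N + 1)) * |x| ^ N := by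
      set n := i + (N + 1) with hn
      have hNn : N < n := by omega
      rcases le_or_gt 1 |L n * x| with hx | hx
      · have : χ (L n * x) = 0 := χ.zero_of_le_dist (by simpa [χ] using hx)
        simp only [u, this, mul_zero, norm_zero]
        positivity
      · rw [abs_mul, abs_of_pos (hL0 n), ← lt_div_iff₀' (hL0 n), one_div] at hx
        calc ‖u n x‖ = |c n| * |x| ^ n * χ (L n * x) := by
              simp [u, abs_of_nonneg χ.nonneg]
          _ ≤ |c n| * |x| ^ n * 1 := by gcongr; exact χ.le_one
          _ = |c n| * |x| ^ (n - N) * |x| ^ N := by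
              rw [mul_one, mul_assoc, ← pow_add, Nat.sub_add_cancel hNn.le]
          _ ≤ |c n| * (L n)⁻¹ ^ (n - N) * |x| ^ N := by gcongr
          _ ≤ |c n| * M n * (L n)⁻¹ * |x| ^ N := by
              have := hLp hNn
              have := inv_nonneg.2 (hL0 n).le
              have := hM1 n
              gcongr
              exact le_mul_of_one_le_right (abs_nonneg _) this
          _ ≤ _ := by
              gcongr
              simpa [div_eq_mul_inv] using hLc n
    have hsumN : Summable fun i : ℕ => ((1 : ℝ) / 2) ^ (i + (N + 1)) :=
      (summable_nat_add_iff (N + 1)).2 hsum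
    have hO : (fun x => ∑' i, u (i + (N + 1)) x) =O[𝓝 0] fun x : ℝ => x ^ N := by
      refine .of_bound (∑' i : ℕ, (1 / 2 : ℝ) ^ (i + (N + 1))) (.of_forall fun x => ?_)
      rw [norm_pow, Real.norm_eq_abs x, ← tsum_mul_right]
      exact tsum_of_norm_bounded (hsumN.mul_right _).hasSum (htail x)
    have hO' := ((isBigO_refl (fun x : ℝ => x ^ N) (𝓝 0)).const_mul_left (c N)).add hO
    refine hO'.congr' ?_ .rfl
    filter_upwards [hhead] with x hx
    rw [← (hsummable x).sum_add_tsum_nat_add (N + 1), Finset.sum_congr rfl hx,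
      Finset.sum_range_succ]
    ring

/-- An even smooth function has an even Taylor expansion at `0`. -/
theorem ContDiff.exists_sub_sum_even_isBigO {f : ℝ → ℝ} (hf : ContDiff ℝ ∞ f)
    (heven : ∀ t, f (-t) = f t) :
    ∃ c : ℕ → ℝ, ∀ N : ℕ,
      (fun t => f t - ∑ n ∈ Finset.range N, c n * (t ^ 2) ^ n) =O[𝓝 0] fun t => (t ^ 2) ^ N := by
  let E := {F : ℝ → ℝ // ContDiff ℝ ∞ F ∧ ∀ t, F (-t) = F t}
  have hstep (F : E) : ∃ G : E, ∀ t, F.1 t = F.1 0 + t ^ 2 * G.1 t := by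
    obtain ⟨F, hF, hFe⟩ := F
    obtain ⟨q, hq, h⟩ := (hF.sub (contDiff_const (c := F 0))).exists_eq_mul_of_zero (sub_self _)
    have hqc := hq.continuous
    have hqo : (fun t => q (-t)) = fun t => -q t :=
      eq_of_forall_ne_zero (by fun_prop) (by fun_prop) fun t ht => mul_left_cancel₀ ht <| by
        linarith [h t, h (-t), hFe t]
    have hq0 : q 0 = 0 := by
      have := congrFun hqo 0
      simp only [neg_zero] at this
      linarith
    obtain ⟨r, hr, h'⟩ := hq.exists_eq_mul_of_zero hq0
    have hrc := hr.continuous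
    have hre : (fun t => r (-t)) = r :=
      eq_of_forall_ne_zero (by fun_prop) hrc fun t ht => mul_left_cancel₀ ht <| by
        linarith [h' t, h' (-t), congrFun hqo t]
    refine ⟨⟨r, hr, congrFun hre⟩, fun t => ?_⟩
    have := h t
    rw [h' t] at this
    simp only
    linear_combination this
  choose G hG using hstep
  let F : ℕ → E := fun n => G^[n] ⟨f, hf, heven⟩
  refine ⟨fun n => (F n).1 0, fun N => ?_⟩
  have hexp (N : ℕ) (t : ℝ) :
      f t - ∑ n ∈ Finset.range N, (F n).1 0 * (t ^ 2) ^ n = (t ^ 2) ^ N * (F N).1 t := by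
    induction N with
    | zero => simp [F]
    | succ N ih =>
      have hs : F (N + 1) = G (F N) := Function.iterate_succ_apply' _ _ _
      rw [Finset.sum_range_succ, hs]
      linear_combination ih + (t ^ 2) ^ N * hG (F N) t
  simp only [← pow_mul] at hexp ⊢
  exact isBigO_pow_of_eq_pow_mul (F N).2.1.continuous (hexp N)

/-- **Whitney's theorem** on even functions. -/
theorem ContDiff.exists_eq_comp_sq_of_even {f : ℝ → ℝ} (hf : ContDiff ℝ ∞ f)
    (heven : ∀ t, f (-t) = f t) :
    ∃ h : ℝ → ℝ, ContDiff ℝ ∞ h ∧ ∀ t, f t = h (t ^ 2) := by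
  obtain ⟨c, hc⟩ := hf.exists_sub_sum_even_isBigO heven
  obtain ⟨b, hb, hbc⟩ := exists_contDiff_sub_sum_isBigO c
  have hsq : Tendsto (fun t : ℝ => t ^ 2) (𝓝 0) (𝓝 0) := by
    simpa using (continuous_pow 2).tendsto (0 : ℝ)
  have hflat : IsFlatAtZero fun t => f t - b (t ^ 2) := by
    refine ⟨hf.sub (hb.comp (contDiff_id.pow 2)), fun N => ?_⟩
    have h₁ : (fun t => f t - b (t ^ 2)) =O[𝓝 0] fun t => (t ^ 2) ^ N :=
      ((hc N).sub ((hbc N).comp_tendsto hsq)).congr_left fun t => by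
        simp only [Function.comp_apply]
        ring
    refine h₁.trans (isBigO_pow_of_eq_pow_mul (continuous_pow N) fun t => ?_)
    ring
  refine ⟨fun x => b x + (f (√x) - b (√x ^ 2)), hb.add hflat.contDiff_comp_sqrt, fun t => ?_⟩
  have habs : f |t| = f t := by
    rcases abs_choice t with h | h <;> rw [h]
    exact heven t
  simp only [Real.sqrt_sq_eq_abs, habs, sq_abs]
  ring

/-- A smooth odd function `g : ℝ → ℝ` can be written `g(t) = t·h(t²)` with `h`
smooth. -/
theorem stmt_5 (g : ℝ → ℝ) (hg : ContDiff ℝ (⊤ : ℕ∞) g) (hodd : ∀ t, g (-t) = -g t) :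
    ∃ h : ℝ → ℝ, ContDiff ℝ (⊤ : ℕ∞) h ∧ ∀ t, g t = t * h (t ^ 2) := by
  have hg0 : g 0 = 0 := by
    have := hodd 0
    rw [neg_zero] at this
    linarith
  obtain ⟨f, hf, hgf⟩ := hg.exists_eq_mul_of_zero hg0
  have hfc := hf.continuous
  have heven : (fun t => f (-t)) = f :=
    eq_of_forall_ne_zero (by fun_prop) hfc fun t ht => mul_left_cancel₀ ht <| by
      linarith [hgf t, hgf (-t), hodd t]
  obtain ⟨h, hh, hfh⟩ := hf.exists_eq_comp_sq_of_even (congrFun heven)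
  exact ⟨h, hh, fun t => by rw [hgf, hfh]⟩
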